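/- arXiv:1712.09452 — 4 statements merged into one kernel-verified Lean document; each statement's English description precedes it below -/
import Mathlib

section
/- Let (Ω, ℰ, m) be a finite measure space. The kernel 𝓛(A,B) = m(A Δ B) (measure of the symmetric difference) is a negative definite kernel on the measurable sets: for every positive integer n, all measurable sets A₁, …, Aₙ ∈ ℰ and all real constants c₁, …, cₙ with ∑ₖ cₖ = 0, one has ∑ᵢ∑ⱼ m(Aᵢ Δ Aⱼ) cᵢ cⱼ ≤ 0. -/
open MeasureTheory

/-- The kernel `𝓛(A,B) = m(A Δ B)` is a negative definite kernel on the
measurable sets of a finite measure space. -/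
theorem symmDiff_measure_negative_definite
    {Ω : Type*} [MeasurableSpace Ω] (m : Measure Ω) [IsFiniteMeasure m]
    (n : ℕ) (hn : 0 < n) (A : Fin n → Set Ω) (hA : ∀ i, MeasurableSet (A i))
    (c : Fin n → ℝ) (hc : ∑ k, c k = 0) :
    ∑ i, ∑ j, (m (symmDiff (A i) (A j))).toReal * c i * c j ≤ 0 := by
  classical
  have key : ∀ i j, (m (symmDiff (A i) (A j))).toReal * c i * c j
      = ∫ x, (symmDiff (A i) (A j)).indicator (fun _ => (1 : ℝ)) x * c i * c j ∂m := by
    intro i j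
    rw [integral_mul_const, integral_mul_const,
      integral_indicator ((hA i).symmDiff (hA j))]
    simp [Measure.real]
  have hint : ∀ i j, Integrable
      (fun x => (symmDiff (A i) (A j)).indicator (fun _ => (1 : ℝ)) x * c i * c j) m := by
    intro i j
    exact ((((integrable_const (1 : ℝ)).indicator
      ((hA i).symmDiff (hA j))).mul_const _).mul_const _)
  simp_rw [key]
  have h1 : ∀ i, ∑ j, ∫ x, (symmDiff (A i) (A j)).indicator (fun _ => (1 : ℝ)) x * c i * c j ∂m
      = ∫ x, ∑ j, (symmDiff (A i) (A j)).indicator (fun _ => (1 : ℝ)) x * c i * c j ∂m :=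
    fun i => (integral_finsetSum _ (fun j _ => hint i j)).symm
  simp_rw [h1]
  rw [← integral_finsetSum _ (fun i _ => integrable_finsetSum _ (fun j _ => hint i j))]
  apply integral_nonpos
  intro x
  set a : Fin n → ℝ := fun i => (A i).indicator (fun _ => (1 : ℝ)) x with ha
  have hpt : ∀ i j, (symmDiff (A i) (A j)).indicator (fun _ => (1 : ℝ)) x * c i * c j
      = (a i * c i) * c j + c i * (a j * c j) - 2 * ((a i * c i) * (a j * c j)) := by
    intro i j
    by_cases h1 : x ∈ A i <;> by_cases h2 : x ∈ A j <;>
      simp [ha, Set.indicator, Set.mem_symmDiff, h1, h2] <;> ring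
  have : ∑ i, ∑ j, (symmDiff (A i) (A j)).indicator (fun _ => (1 : ℝ)) x * c i * c j
      = -2 * (∑ i, a i * c i) ^ 2 := by
    simp_rw [hpt, Finset.sum_sub_distrib, Finset.sum_add_distrib, ← Finset.mul_sum,
      ← Finset.sum_mul, hc]
    ring
  change ∑ i, ∑ j, (symmDiff (A i) (A j)).indicator (fun _ => (1 : ℝ)) x * c i * c j ≤ 0
  rw [this]
  nlinarith [sq_nonneg (∑ i, a i * c i)]
end

section
/- Let (Ω, ℰ, m) be a finite measure space, A₁, …, Aₙ ∈ ℰ measurable sets, and c₁, …, cₙ real constants with ∑ₖ cₖ = 0. Then ∑ᵢ∑ⱼ m(Aᵢ Δ Aⱼ) cᵢ cⱼ = −2 ∫_Ω (∑ₖ cₖ 𝟙_{Aₖ}(x))² dm(x). -/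
open MeasureTheory

/-- For measurable sets `A₁, …, Aₙ` in a finite measure space and real constants
`c₁, …, cₙ` with `∑ cₖ = 0`, one has
`∑ᵢ∑ⱼ m(Aᵢ Δ Aⱼ) cᵢ cⱼ = −2 ∫ (∑ₖ cₖ 𝟙_{Aₖ})² dm`. -/
theorem sum_symmDiff_measure_mul_eq_neg_two_integral
    {Ω : Type*} [MeasurableSpace Ω] (m : Measure Ω) [IsFiniteMeasure m]
    (n : ℕ) (A : Fin n → Set Ω) (hA : ∀ i, MeasurableSet (A i))
    (c : Fin n → ℝ) (hc : ∑ k, c k = 0) :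
    ∑ i, ∑ j, (m (symmDiff (A i) (A j))).toReal * c i * c j
      = -2 * ∫ x, (∑ k, c k * (A k).indicator (fun _ => (1 : ℝ)) x) ^ 2 ∂m := by
  have hint : ∀ i j, Integrable
      (fun x => (symmDiff (A i) (A j)).indicator (fun _ => (1 : ℝ)) x * c i * c j) m := by
    intro i j
    exact (((integrable_const (1 : ℝ)).indicator ((hA i).symmDiff (hA j))).mul_const _).mul_const _
  have h1 : ∀ i j, (m (symmDiff (A i) (A j))).toReal * c i * c j
      = ∫ x, (symmDiff (A i) (A j)).indicator (fun _ => (1 : ℝ)) x * c i * c j ∂m := by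
    intro i j
    rw [integral_mul_const, integral_mul_const, integral_indicator_const _ ((hA i).symmDiff (hA j))]
    simp [Measure.real]
  simp_rw [h1]
  have h2 : ∀ i, ∑ j, ∫ x, (symmDiff (A i) (A j)).indicator (fun _ => (1 : ℝ)) x * c i * c j ∂m
      = ∫ x, ∑ j, (symmDiff (A i) (A j)).indicator (fun _ => (1 : ℝ)) x * c i * c j ∂m := by
    intro i
    rw [integral_finsetSum _ (fun j _ => hint i j)]
  simp_rw [h2]
  rw [← integral_finsetSum _ (fun i _ => integrable_finsetSum _ (fun j _ => hint i j)),
    ← integral_const_mul]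
  congr 1
  funext x
  have h3 : ∀ i j, (symmDiff (A i) (A j)).indicator (fun _ => (1 : ℝ)) x * c i * c j
      = (c i * (A i).indicator (fun _ => (1 : ℝ)) x) * c j
        + c i * (c j * (A j).indicator (fun _ => (1 : ℝ)) x)
        - 2 * ((c i * (A i).indicator (fun _ => (1 : ℝ)) x)
          * (c j * (A j).indicator (fun _ => (1 : ℝ)) x)) := by
    intro i j
    by_cases hi : x ∈ A i <;> by_cases hj : x ∈ A j <;>
      simp [Set.indicator, Set.mem_symmDiff, hi, hj] <;> ring
  simp_rw [h3, Finset.sum_sub_distrib, Finset.sum_add_distrib, ← Finset.mul_sum,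
    ← Finset.sum_mul, hc]
  ring
end

section
/- Let Ω be a set, let f_𝔹, h : Ω → ℝ with 0 ≤ f_𝔹 ≤ 1, 0 ≤ h ≤ 1 and f_𝔹(x)·h(x) = 0 for all x, and suppose f_𝔹 is stable: for each integer n ≥ 1 there is κₙ > 0 with f_𝔹ⁿ(x) = κₙ f_𝔹(x) for all x. Let p₁ > 0, p₂ ≥ 0 and f_𝔸 = p₁ f_𝔹 + p₂ h, and assume p₂ⁿ/(p₁ⁿ κₙ) → 0 as n → ∞. Then there exists a sequence of positive constants λₙ (namely λₙ = 1/(p₁ⁿ κₙ)) such that λₙ (f_𝔸(x))ⁿ → f_𝔹(x) as n → ∞, for every x ∈ Ω. -/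
open Filter

/-- If `f_𝔹` is a stable function with normalizing constants `κₙ`, `h` satisfies
`0 ≤ h ≤ 1` and `f_𝔹 · h = 0`, and `f_𝔸 = p₁ f_𝔹 + p₂ h` with `p₁ > 0`, `p₂ ≥ 0`
and `p₂ⁿ/(p₁ⁿ κₙ) → 0`, then there are positive constants `λₙ` with
`λₙ (f_𝔸(x))ⁿ → f_𝔹(x)` for every `x`. -/
theorem tendsto_normalized_pow_to_stable
    {Ω : Type*} (fB h : Ω → ℝ)
    (hfB0 : ∀ x, 0 ≤ fB x) (hfB1 : ∀ x, fB x ≤ 1)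
    (hh0 : ∀ x, 0 ≤ h x) (hh1 : ∀ x, h x ≤ 1)
    (horth : ∀ x, fB x * h x = 0)
    (κ : ℕ → ℝ) (hκpos : ∀ n, 1 ≤ n → 0 < κ n)
    (hstable : ∀ n, 1 ≤ n → ∀ x, (fB x) ^ n = κ n * fB x)
    (p₁ p₂ : ℝ) (hp₁ : 0 < p₁) (hp₂ : 0 ≤ p₂)
    (hlim : Tendsto (fun n : ℕ => p₂ ^ n / (p₁ ^ n * κ n)) atTop (nhds 0)) :
    ∃ lam : ℕ → ℝ, (∀ n, 1 ≤ n → 0 < lam n) ∧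
      ∀ x, Tendsto (fun n : ℕ => lam n * (p₁ * fB x + p₂ * h x) ^ n)
        atTop (nhds (fB x)) := by
  refine ⟨fun n => 1 / (p₁ ^ n * κ n), fun n hn => ?_, fun x => ?_⟩
  · have := hκpos n hn
    positivity
  · rcases mul_eq_zero.mp (horth x) with h0 | h0
    · rw [h0]
      refine tendsto_of_tendsto_of_tendsto_of_le_of_le' tendsto_const_nhds hlim ?_ ?_
      · filter_upwards [eventually_ge_atTop 1] with n hn
        have := hκpos n hn
        have := hh0 x
        positivity
      · filter_upwards [eventually_ge_atTop 1] with n hn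
        have hk := hκpos n hn
        have h1 : (h x) ^ n ≤ 1 := pow_le_one₀ (hh0 x) (hh1 x)
        have h2 : (p₁ * 0 + p₂ * h x) ^ n ≤ p₂ ^ n := by
          rw [mul_zero, zero_add, mul_pow]
          exact mul_le_of_le_one_right (by positivity) h1
        rw [one_div_mul_eq_div]
        gcongr
    · refine tendsto_const_nhds.congr' ?_
      filter_upwards [eventually_ge_atTop 1] with n hn
      have hk := hκpos n hn
      rw [h0, mul_zero, add_zero, mul_pow, hstable n hn x]
      field_simp
end

section
/- Let Ω be a set, let A₁ ⊂ A₂ ⊂ A₃ ⊂ … be a strictly increasing chain of subsets of Ω, and for a parameter a ∈ (0,1) consider the discrete random set 𝔸_a taking value Aⱼ with probability pⱼ(a) = a(1−a)^{j−1}, with associated function f_a(x) = ∑_{j=1}^∞ a(1−a)^{j−1} 𝟙_{Aⱼ}(x). Define ξₙ(a) = 1 − (1−a)ⁿ. Then the family 𝔸_a is stable with respect to the transformations a ↦ ξₙ(a): for every positive integer n and every x ∈ Ω, (f_a(x))ⁿ = f_{ξₙ(a)}(x). -/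
theorem chain_tsum_aux {Ω : Type*} (A : ℕ → Set Ω) (x : Ω) (m : ℕ)
    (hm : ∀ j, x ∈ A j ↔ m ≤ j) (b : ℝ) (hb : 0 < b) (hb1 : b < 1) :
    ∑' j, b * (1 - b) ^ j * (A j).indicator (fun _ => (1 : ℝ)) x = (1 - b) ^ m := by
  have h1 : HasSum (fun j : ℕ => (1 - b) ^ j) (1 - (1 - b))⁻¹ :=
    hasSum_geometric_of_lt_one (by linarith) (by linarith)
  have h2 := h1.mul_left (b * (1 - b) ^ m)
  have h3 : HasSum (fun j => b * (1 - b) ^ j * (A j).indicator (fun _ => (1 : ℝ)) x)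
      ((1 - b) ^ m) := by
    rw [← hasSum_nat_add_iff' m]
    have h0 : ∑ j ∈ Finset.range m,
        b * (1 - b) ^ j * (A j).indicator (fun _ => (1 : ℝ)) x = 0 := by
      apply Finset.sum_eq_zero
      intro j hj
      have hx : x ∉ A j := by
        rw [hm, not_le]
        exact Finset.mem_range.mp hj
      simp [hx]
    rw [h0, sub_zero]
    convert h2 using 1
    · rfl
    · funext j
      have hx : x ∈ A (j + m) := (hm _).2 (Nat.le_add_left m j)
      simp only [Set.indicator_of_mem hx]
      ring
    · have : b ≠ 0 := hb.ne'
      rw [sub_sub_cancel]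
      field_simp
  exact h3.tsum_eq

/-- For a strictly increasing chain `A₁ ⊂ A₂ ⊂ …` and geometric probabilities
`pⱼ(a) = a(1−a)^{j−1}`, the family of random sets with associated functions
`f_a = ∑ⱼ a(1−a)^{j−1} 𝟙_{Aⱼ}` is stable with respect to the transformations
`ξₙ(a) = 1 − (1−a)ⁿ`: one has `(f_a(x))ⁿ = f_{ξₙ(a)}(x)` for all `n` and `x`. -/
theorem geometric_chain_casual_stable
    {Ω : Type*} (A : ℕ → Set Ω) (hA : ∀ j, A j ⊂ A (j + 1))
    (a : ℝ) (ha : 0 < a) (ha1 : a < 1)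
    (n : ℕ) (hn : 0 < n) (x : Ω) :
    (∑' j, a * (1 - a) ^ j * (A j).indicator (fun _ => (1 : ℝ)) x) ^ n
      = ∑' j, (1 - (1 - a) ^ n) * (1 - (1 - (1 - a) ^ n)) ^ j
          * (A j).indicator (fun _ => (1 : ℝ)) x := by
  classical
  have hmono : Monotone A := monotone_nat_of_le_succ fun j => (hA j).subset
  by_cases hex : ∃ j, x ∈ A j
  · have hm : ∀ j, x ∈ A j ↔ Nat.find hex ≤ j := fun j =>
      ⟨fun h => Nat.find_min' hex h, fun h => hmono h (Nat.find_spec hex)⟩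
    have hp : (1 - a) ^ n < 1 := pow_lt_one₀ (by linarith) (by linarith) hn.ne'
    have hp0 : 0 < (1 - a) ^ n := pow_pos (by linarith) n
    rw [chain_tsum_aux A x _ hm a ha ha1,
      chain_tsum_aux A x _ hm (1 - (1 - a) ^ n) (by linarith) (by linarith),
      sub_sub_cancel, ← pow_mul, ← pow_mul, mul_comm]
  · have hx : ∀ j, x ∉ A j := fun j h => hex ⟨j, h⟩
    simp [hx, hn.ne']
end
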